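/- Let n be a positive integer, let L_1,...,L_n be nonnegative integers, and let A, B be elements of a field of characteristic zero. Then det_{1≤i,j≤n}( (A+B·L_i)^{j−1} / (j−L_i)! ) = ∏_{i=1}^{n} ( (A+B·i)^{i−1} / (n−L_i)! ) · ∏_{1≤i<j≤n}(L_j − L_i), where for an integer m the reciprocal factorial 1/m! is interpreted as 0 when m < 0. -/

import Mathlib

open Finset

/-- `invFact F m` is `1/m!` for `m ≥ 0` and `0` for negative integers `m`. -/
noncomputable def invFact (F : Type*) [Field F] (m : ℤ) : F :=
  if 0 ≤ m then ((m.toNat.factorial : F))⁻¹ else 0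

/-- The recurrence `1/m! = (m+1)/(m+1)!`, valid for all integers `m`. -/
theorem invFact_eq_invFact_add_one_mul (F : Type*) [Field F] [CharZero F] (m : ℤ) :
    invFact F m = invFact F (m + 1) * ((m : F) + 1) := by
  unfold invFact
  rcases lt_trichotomy m (-1) with h | rfl | h
  · rw [if_neg (by omega), if_neg (by omega), zero_mul]
  · simp
  · lift m to ℕ using by omega
    have h₁ : ((m : ℤ) + 1).toNat = m + 1 := by omega
    rw [if_pos (by omega), if_pos (by omega), h₁, Int.toNat_natCast, Nat.factorial_succ]
    have h₂ : (m : F) + 1 ≠ 0 := by exact_mod_cast m.succ_ne_zero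
    have h₃ : (m.factorial : F) ≠ 0 := by exact_mod_cast m.factorial_ne_zero
    push_cast
    field_simp

theorem invFact_sub_eq_mul_prod_Ico (F : Type*) [Field F] [CharZero F] {a n : ℕ} (h : a ≤ n)
    (l : ℕ) :
    invFact F ((a : ℤ) - l) = invFact F ((n : ℤ) - l) * ∏ k ∈ Ico a n, ((k : F) + 1 - l) := by
  induction n, h using Nat.le_induction with
  | base => simp
  | succ n hn ih =>
    rw [prod_Ico_succ_top hn, ih, invFact_eq_invFact_add_one_mul F ((n : ℤ) - l)]
    have e : (n : ℤ) - l + 1 = ((n + 1 : ℕ) : ℤ) - l := by push_cast; ring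
    rw [e]
    push_cast
    ring

theorem Fin.prod_Ioi_val {M : Type*} [CommMonoid M] {n : ℕ} (j : Fin n) (f : ℕ → M) :
    ∏ k ∈ Ioi j, f k = ∏ k ∈ Ico ((j : ℕ) + 1) n, f k := by
  have h : Ico ((j : ℕ) + 1) n = (Ioi j).map Fin.valEmbedding := by
    ext k
    simp only [mem_Ico, mem_map, mem_Ioi, Fin.valEmbedding_apply]
    constructor
    · rintro ⟨h₁, h₂⟩
      exact ⟨⟨k, h₂⟩, h₁, rfl⟩
    · rintro ⟨i, hi, rfl⟩
      exact ⟨hi, i.isLt⟩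
  rw [h, prod_map]
  rfl

/-- Evaluating `n` polynomials of degree less than `n` at `n` points gives a Vandermonde
determinant times the determinant of the coefficients. -/
theorem Matrix.det_eval_eq_det_vandermonde_mul_det_coeff {R : Type*} [CommRing R] {n : ℕ}
    (p : Fin n → Polynomial R) (hp : ∀ j, (p j).natDegree < n) (x : Fin n → R) :
    (Matrix.of fun i j => (p j).eval (x i)).det =
      (Matrix.vandermonde x).det * (Matrix.of fun k j : Fin n => (p j).coeff k).det := by
  rw [← Matrix.det_mul]
  congr 1
  ext i j
  rw [Matrix.of_apply, Polynomial.eval_eq_sum_range' (hp j), Matrix.mul_apply,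
    ← Fin.sum_univ_eq_sum_range (fun k => (p j).coeff k * x i ^ k)]
  simp [Matrix.vandermonde_apply, mul_comm]

/-- The evaluation points `1, …, n` make the matrix triangular, which determines the
determinant of the coefficients. -/
theorem det_pow_mul_prod_sub {F : Type*} [Field F] [CharZero F] {n : ℕ} (A B : F)
    (x : Fin n → F) :
    (Matrix.of fun i j : Fin n =>
        (A + B * x i) ^ (j : ℕ) * ∏ k ∈ Ioi j, (((k : ℕ) : F) + 1 - x i)).det =
      (∏ i : Fin n, (A + B * (((i : ℕ) : F) + 1)) ^ (i : ℕ)) *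
        ∏ i : Fin n, ∏ j ∈ Ioi i, (x j - x i) := by
  let p : Fin n → Polynomial F := fun j =>
    (Polynomial.C A + Polynomial.C B * Polynomial.X) ^ (j : ℕ) *
      ∏ k ∈ Ioi j, (Polynomial.C (((k : ℕ) : F) + 1) - Polynomial.X)
  have hp : ∀ j, (p j).natDegree < n := by
    intro j
    have h₁ : ((Polynomial.C A + Polynomial.C B * Polynomial.X) ^ (j : ℕ)).natDegree ≤
        (j : ℕ) * 1 := Polynomial.natDegree_pow_le_of_le _ (by compute_degree)
    have h₂ : (∏ k ∈ Ioi j, (Polynomial.C (((k : ℕ) : F) + 1) - Polynomial.X)).natDegree ≤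
        ∑ k ∈ Ioi j, 1 := (Polynomial.natDegree_prod_le _ _).trans
      (sum_le_sum fun k _ => Polynomial.natDegree_sub_le_of_le
        (Polynomial.natDegree_C _).le Polynomial.natDegree_X_le)
    rw [sum_const, Fin.card_Ioi, smul_eq_mul, mul_one] at h₂
    refine (Polynomial.natDegree_mul_le_of_le h₁ h₂).trans_lt ?_
    have := j.isLt
    omega
  have heval : ∀ y : Fin n → F, (Matrix.of fun i j : Fin n =>
        (A + B * y i) ^ (j : ℕ) * ∏ k ∈ Ioi j, (((k : ℕ) : F) + 1 - y i)).det =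
      (Matrix.vandermonde y).det * (Matrix.of fun k j : Fin n => (p j).coeff k).det := by
    intro y
    rw [← Matrix.det_eval_eq_det_vandermonde_mul_det_coeff p hp]
    simp [p, Polynomial.eval_prod]
  let y : Fin n → F := fun i => ((i : ℕ) : F) + 1
  have hV : (Matrix.vandermonde y).det ≠ 0 := by
    rw [Matrix.det_vandermonde_ne_zero_iff]
    intro i j hij
    simpa [y, Fin.val_inj] using hij
  have htri : (Matrix.of fun i j : Fin n =>
        (A + B * y i) ^ (j : ℕ) * ∏ k ∈ Ioi j, (((k : ℕ) : F) + 1 - y i)).det =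
      (Matrix.vandermonde y).det * ∏ i : Fin n, (A + B * (((i : ℕ) : F) + 1)) ^ (i : ℕ) := by
    rw [Matrix.det_of_isUpperTriangular, Matrix.det_vandermonde, mul_comm, ← prod_mul_distrib]
    · rfl
    · intro i j hij
      exact mul_eq_zero_of_right _ (prod_eq_zero (mem_Ioi.mpr hij) (sub_self _))
  have hC := mul_left_cancel₀ hV ((heval y).symm.trans htri)
  rw [heval, hC, Matrix.det_vandermonde, mul_comm]

/-- Determinant evaluation (eq. (3.14) of [Krat, "Advanced Determinant Calculus"]):
`det_{1≤i,j≤n}((A+B·L_i)^{j−1}/(j−L_i)!)`, with `1/m! = 0` for negative `m`.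
Rows/columns are indexed by `Fin n` (0-based), so the 1-based indices are
`(i : ℕ) + 1` and `(j : ℕ) + 1`. -/
theorem stmt_11 (n : ℕ) (hn : 0 < n) (F : Type*) [Field F] [CharZero F]
    (L : Fin n → ℕ) (A B : F) :
    Matrix.det (Matrix.of fun i j : Fin n =>
        (A + B * (L i : F)) ^ (j : ℕ) *
          invFact F ((((j : ℕ) + 1 : ℕ) : ℤ) - ((L i : ℕ) : ℤ))) =
      (∏ i : Fin n, (A + B * (((i : ℕ) : F) + 1)) ^ (i : ℕ) *
          invFact F ((n : ℤ) - ((L i : ℕ) : ℤ))) *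
        ∏ i : Fin n, ∏ j ∈ Ioi i, ((L j : F) - (L i : F)) := by
  have hentry : (Matrix.of fun i j : Fin n => (A + B * (L i : F)) ^ (j : ℕ) *
      invFact F ((((j : ℕ) + 1 : ℕ) : ℤ) - ((L i : ℕ) : ℤ))) =
      Matrix.of fun i j : Fin n => invFact F ((n : ℤ) - ((L i : ℕ) : ℤ)) *
        (Matrix.of fun i j : Fin n => (A + B * (L i : F)) ^ (j : ℕ) *
          ∏ k ∈ Ioi j, (((k : ℕ) : F) + 1 - (L i : F))) i j := by
    ext i j
    simp only [Matrix.of_apply]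
    rw [invFact_sub_eq_mul_prod_Ico F (show (j : ℕ) + 1 ≤ n from j.isLt),
      Fin.prod_Ioi_val j (fun k => (k : F) + 1 - (L i : F))]
    ring
  rw [hentry, Matrix.det_mul_column, det_pow_mul_prod_sub, prod_mul_distrib]
  ring
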